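/- Fix α > 0 and q ∈ (0,1). Set γ1 = [q(α−1) + √(q²(α−1)² + 4qα)]/2 and β1 = [(2α+1) − √((2α+1)² − 4(α² − α·γ1))]/2. Then (β1, γ1) lies in the open region {(β, γ) : 0 < β, 0 < γ, β + γ < α}, it is the unique point of this region where both partial derivatives of h vanish, and h attains its global minimum over this region at (β1, γ1). -/

import Mathlib

noncomputable section

/-- The exponent function `h(β,γ)` (for parameters `α` and `q`). -/
def hfun (α q β γ : ℝ) : ℝ :=
  (α - β - γ) * Real.log (α - β - γ) - (1 + α - β + γ) * Real.log (1 + α - β + γ)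
    + (α - β) * Real.log (α - β) - (1 + α - β) * Real.log (1 + α - β)
    - 3 * α * Real.log α + (1 + α) * Real.log (1 + α)
    + β * Real.log β + (1 + 2 * α - β) * Real.log (1 + 2 * α - β)
    + 2 * γ * Real.log γ - γ * Real.log q - (α - γ) * Real.log (1 - q)

/-- `γ1 = (q(α−1) + √(q²(α−1)² + 4qα))/2`. -/
def gamma1 (α q : ℝ) : ℝ :=
  (q * (α - 1) + Real.sqrt (q ^ 2 * (α - 1) ^ 2 + 4 * q * α)) / 2

/-- `β1 = ((2α+1) − √((2α+1)² − 4(α² − α γ1)))/2`. -/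
def beta1 (α q : ℝ) : ℝ :=
  ((2 * α + 1) - Real.sqrt ((2 * α + 1) ^ 2 - 4 * (α ^ 2 - α * gamma1 α q))) / 2

/-- The partial derivative of `hfun α q` in its first variable. -/
def hfunPartialBeta (α β γ : ℝ) : ℝ :=
  Real.log (1 + α - β + γ) + Real.log (1 + α - β) + Real.log β
    - (Real.log (α - β - γ) + Real.log (α - β) + Real.log (1 + 2 * α - β))

/-- The partial derivative of `hfun α q` in its second variable. -/
def hfunPartialGamma (α q β γ : ℝ) : ℝ :=
  2 * Real.log γ + Real.log (1 - q)
    - (Real.log (α - β - γ) + Real.log (1 + α - β + γ) + Real.log q)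

theorem HasDerivAt.mul_log_self {f : ℝ → ℝ} {f' x : ℝ} (hf : HasDerivAt f f' x) (hx : f x ≠ 0) :
    HasDerivAt (fun y => f y * Real.log (f y)) ((Real.log (f x) + 1) * f') x :=
  (Real.hasDerivAt_mul_log hx).comp x hf

theorem hasDerivAt_hfun_comp {α q : ℝ} {b g : ℝ → ℝ} {b' g' t : ℝ}
    (hb : HasDerivAt b b' t) (hg : HasDerivAt g g' t)
    (hb0 : 0 < b t) (hg0 : 0 < g t) (hbg : b t + g t < α) :
    HasDerivAt (fun s => hfun α q (b s) (g s))
      (hfunPartialBeta α (b t) (g t) * b' + hfunPartialGamma α q (b t) (g t) * g') t := by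
  have hA := ((hb.const_sub α).sub hg).mul_log_self (by simp only [Pi.sub_apply]; linarith)
  have hB := ((hb.const_sub (1 + α)).add hg).mul_log_self (by simp only [Pi.add_apply]; linarith)
  have hC := (hb.const_sub α).mul_log_self (by linarith)
  have hD := (hb.const_sub (1 + α)).mul_log_self (by linarith)
  have hE := hb.mul_log_self hb0.ne'
  have hF := (hb.const_sub (1 + 2 * α)).mul_log_self (by linarith)
  have hG := (hg.mul_log_self hg0.ne').const_mul 2
  have hq := hg.mul_const (Real.log q)
  have hp := (hg.const_sub α).mul_const (Real.log (1 - q))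
  have h := (((((((((hA.sub hB).add hC).sub hD).sub_const (3 * α * Real.log α)).add_const
    ((1 + α) * Real.log (1 + α))).add hE).add hF).add hG).sub hq).sub hp
  refine (h.congr_deriv ?_).congr_of_eventuallyEq (Filter.Eventually.of_forall fun s => ?_)
  · simp only [hfunPartialBeta, hfunPartialGamma, Pi.sub_apply, Pi.add_apply]
    ring
  · simp only [hfun, Pi.sub_apply, Pi.add_apply]
    ring

theorem hasDerivAt_hfun_left {α q β γ : ℝ} (hβ : 0 < β) (hγ : 0 < γ) (h : β + γ < α) :
    HasDerivAt (fun b => hfun α q b γ) (hfunPartialBeta α β γ) β := by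
  simpa using hasDerivAt_hfun_comp (q := q) (hasDerivAt_id β) (hasDerivAt_const β γ) hβ hγ h

theorem hasDerivAt_hfun_right {α q β γ : ℝ} (hβ : 0 < β) (hγ : 0 < γ) (h : β + γ < α) :
    HasDerivAt (fun g => hfun α q β g) (hfunPartialGamma α q β γ) γ := by
  simpa using hasDerivAt_hfun_comp (q := q) (hasDerivAt_const γ β) (hasDerivAt_id γ) hβ hγ h

theorem hfunPartialBeta_eq_log {α β γ : ℝ} (hβ : 0 < β) (hγ : 0 < γ) (h : β + γ < α) :
    hfunPartialBeta α β γ = Real.log ((1 + α - β + γ) * (1 + α - β) * β)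
      - Real.log ((α - β - γ) * (α - β) * (1 + 2 * α - β)) := by
  have hA : α - β - γ ≠ 0 := by linarith
  have hB : 1 + α - β + γ ≠ 0 := by linarith
  have hC : α - β ≠ 0 := by linarith
  have hD : 1 + α - β ≠ 0 := by linarith
  have hF : 1 + 2 * α - β ≠ 0 := by linarith
  rw [Real.log_mul (mul_ne_zero hB hD) hβ.ne', Real.log_mul hB hD,
    Real.log_mul (mul_ne_zero hA hC) hF, Real.log_mul hA hC, hfunPartialBeta]

theorem hfunPartialGamma_eq_log {α q β γ : ℝ} (hq0 : 0 < q) (hq1 : q < 1)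
    (hγ : 0 < γ) (h : β + γ < α) :
    hfunPartialGamma α q β γ = Real.log (γ ^ 2 * (1 - q))
      - Real.log ((α - β - γ) * (1 + α - β + γ) * q) := by
  have hA : α - β - γ ≠ 0 := by linarith
  have hB : 1 + α - β + γ ≠ 0 := by linarith
  have hp : 1 - q ≠ 0 := by linarith
  rw [Real.log_mul (pow_ne_zero 2 hγ.ne') hp, Real.log_pow,
    Real.log_mul (mul_ne_zero hA hB) hq0.ne', Real.log_mul hA hB, hfunPartialGamma]
  norm_num

theorem sign_log_sub_log {x y : ℝ} (hx : 0 < x) (hy : 0 < y) :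
    SignType.sign (Real.log x - Real.log y) = SignType.sign (x - y) := by
  rcases lt_trichotomy x y with h | h | h
  · rw [sign_neg (sub_neg.2 (Real.log_lt_log hx h)), sign_neg (sub_neg.2 h)]
  · simp [h]
  · rw [sign_pos (sub_pos.2 (Real.log_lt_log hy h)), sign_pos (sub_pos.2 h)]

theorem sign_hfunPartialBeta {α β γ : ℝ} (hβ : 0 < β) (hγ : 0 < γ) (h : β + γ < α) :
    SignType.sign (hfunPartialBeta α β γ) =
      SignType.sign (α * (γ + 1) - ((α - β) ^ 2 + (α - β))) := by
  have hA : 0 < α - β - γ := by linarith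
  have hB : 0 < 1 + α - β + γ := by linarith
  have hC : 0 < α - β := by linarith
  have hD : 0 < 1 + α - β := by linarith
  have hF : 0 < 1 + 2 * α - β := by linarith
  have hpos : 0 < 2 * (α - β) + 1 := by linarith
  rw [hfunPartialBeta_eq_log hβ hγ h, sign_log_sub_log (by positivity) (by positivity),
    show (1 + α - β + γ) * (1 + α - β) * β - (α - β - γ) * (α - β) * (1 + 2 * α - β)
      = (2 * (α - β) + 1) * (α * (γ + 1) - ((α - β) ^ 2 + (α - β))) by ring,
    sign_mul, sign_pos hpos, one_mul]

theorem sign_hfunPartialGamma {α q β γ : ℝ} (hq0 : 0 < q) (hq1 : q < 1)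
    (hγ : 0 < γ) (h : β + γ < α)
    (hcurve : (α - β) ^ 2 + (α - β) = α * (γ + 1)) :
    SignType.sign (hfunPartialGamma α q β γ) =
      SignType.sign (γ ^ 2 - q * ((α - 1) * γ + α)) := by
  have hA : 0 < α - β - γ := by linarith
  have hB : 0 < 1 + α - β + γ := by linarith
  have hp : 0 < 1 - q := by linarith
  rw [hfunPartialGamma_eq_log hq0 hq1 hγ h,
    sign_log_sub_log (by positivity) (by positivity)]
  congr 1
  linear_combination -q * hcurve

theorem hfunPartialBeta_eq_zero_iff {α β γ : ℝ} (hβ : 0 < β) (hγ : 0 < γ) (h : β + γ < α) :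
    hfunPartialBeta α β γ = 0 ↔ (α - β) ^ 2 + (α - β) = α * (γ + 1) := by
  rw [← sign_eq_zero_iff, sign_hfunPartialBeta hβ hγ h, sign_eq_zero_iff, sub_eq_zero, eq_comm]

theorem hfunPartialGamma_eq_zero_iff {α q β γ : ℝ} (hq0 : 0 < q) (hq1 : q < 1)
    (hγ : 0 < γ) (h : β + γ < α)
    (hcurve : (α - β) ^ 2 + (α - β) = α * (γ + 1)) :
    hfunPartialGamma α q β γ = 0 ↔ γ ^ 2 = q * ((α - 1) * γ + α) := by
  rw [← sign_eq_zero_iff, sign_hfunPartialGamma hq0 hq1 hγ h hcurve, sign_eq_zero_iff,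
    sub_eq_zero]

/-- A function whose derivative is nonpositive before `c` and nonnegative after `c` is
minimal at `c`. -/
theorem isMinOn_Ioo_of_hasDerivAt {f f' : ℝ → ℝ} {a b c : ℝ} (hc : c ∈ Set.Ioo a b)
    (hf : ∀ x ∈ Set.Ioo a b, HasDerivAt f (f' x) x)
    (hneg : ∀ x ∈ Set.Ioo a c, f' x ≤ 0) (hpos : ∀ x ∈ Set.Ioo c b, 0 ≤ f' x) :
    IsMinOn f (Set.Ioo a b) c := by
  intro x hx
  rcases lt_trichotomy x c with h | rfl | h
  · have hsub : Set.Icc x c ⊆ Set.Ioo a b := Set.Icc_subset_Ioo hx.1 hc.2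
    obtain ⟨y, hy, hslope⟩ := exists_hasDerivAt_eq_slope f f' h
      (fun y hy => (hf y (hsub hy)).continuousAt.continuousWithinAt)
      (fun y hy => hf y (hsub (Set.Ioo_subset_Icc_self hy)))
    have hle := hneg y ⟨hx.1.trans hy.1, hy.2⟩
    rw [hslope, div_le_iff₀ (sub_pos.2 h), zero_mul] at hle
    exact sub_nonpos.1 hle
  · exact le_refl (f x)
  · have hsub : Set.Icc c x ⊆ Set.Ioo a b := Set.Icc_subset_Ioo hc.1 hx.2
    obtain ⟨y, hy, hslope⟩ := exists_hasDerivAt_eq_slope f f' h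
      (fun y hy => (hf y (hsub hy)).continuousAt.continuousWithinAt)
      (fun y hy => hf y (hsub (Set.Ioo_subset_Icc_self hy)))
    have hle := hpos y ⟨hy.1, hy.2.trans hx.2⟩
    rw [hslope, le_div_iff₀ (sub_pos.2 h), zero_mul] at hle
    exact sub_nonneg.1 hle

theorem gamma1_pos {α q : ℝ} (hα : 0 < α) (hq0 : 0 < q) : 0 < gamma1 α q := by
  have h : |q * (α - 1)| < Real.sqrt (q ^ 2 * (α - 1) ^ 2 + 4 * q * α) := by
    refine Real.lt_sqrt_of_sq_lt ?_
    rw [sq_abs, mul_pow]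
    have : 0 < 4 * q * α := by positivity
    linarith
  have := neg_abs_le (q * (α - 1))
  unfold gamma1
  linarith

theorem gamma1_sq {α q : ℝ} (hα : 0 < α) (hq0 : 0 < q) :
    gamma1 α q ^ 2 = q * ((α - 1) * gamma1 α q + α) := by
  have h : Real.sqrt (q ^ 2 * (α - 1) ^ 2 + 4 * q * α) ^ 2 = q ^ 2 * (α - 1) ^ 2 + 4 * q * α :=
    Real.sq_sqrt (by positivity)
  unfold gamma1
  linear_combination h / 4

theorem sub_gamma1_factor {α q γ : ℝ} (hα : 0 < α) (hq0 : 0 < q) :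
    gamma1 α q * (γ ^ 2 - q * ((α - 1) * γ + α)) =
      (γ - gamma1 α q) * (gamma1 α q * γ + q * α) := by
  linear_combination γ * gamma1_sq hα hq0

theorem sign_sub_gamma1 {α q γ : ℝ} (hα : 0 < α) (hq0 : 0 < q) (hγ : 0 < γ) :
    SignType.sign (γ ^ 2 - q * ((α - 1) * γ + α)) = SignType.sign (γ - gamma1 α q) := by
  have h1 := gamma1_pos hα hq0
  have h2 : 0 < gamma1 α q * γ + q * α := by positivity
  have h := congrArg SignType.sign (sub_gamma1_factor (γ := γ) hα hq0)
  rwa [sign_mul, sign_mul, sign_pos h1, sign_pos h2, one_mul, mul_one] at h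

theorem gamma1_lt {α q : ℝ} (hα : 0 < α) (hq0 : 0 < q) (hq1 : q < 1) : gamma1 α q < α := by
  have h : 0 < α ^ 2 - q * ((α - 1) * α + α) := by
    have : 0 < α ^ 2 * (1 - q) := mul_pos (by positivity) (by linarith)
    linarith
  have hs := sign_sub_gamma1 hα hq0 hα
  rw [sign_pos h] at hs
  exact sub_pos.1 (sign_eq_one_iff.1 hs.symm)

/-- The smaller root `β` of `β² - (2α+1)β + α² - αγ`, written in terms of `α - β`. -/
theorem smaller_root_spec {α γ β : ℝ} (hα : 0 < α) (hγ0 : 0 ≤ γ) (hγ : γ < α)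
    (hβ : β = ((2 * α + 1) - Real.sqrt ((2 * α + 1) ^ 2 - 4 * (α ^ 2 - α * γ))) / 2) :
    0 < β ∧ β + γ < α ∧ (α - β) ^ 2 + (α - β) = α * (γ + 1) := by
  have hnn : 0 ≤ (2 * α + 1) ^ 2 - 4 * (α ^ 2 - α * γ) := by nlinarith [mul_nonneg hα.le hγ0]
  have hsq := Real.sq_sqrt hnn
  have hs0 := Real.sqrt_nonneg ((2 * α + 1) ^ 2 - 4 * (α ^ 2 - α * γ))
  set s := Real.sqrt ((2 * α + 1) ^ 2 - 4 * (α ^ 2 - α * γ))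
  have h1 : s < 2 * α + 1 := by
    refine lt_of_pow_lt_pow_left₀ 2 (by linarith) ?_
    nlinarith [mul_pos hα (sub_pos.2 hγ)]
  have h2 : 2 * γ + 1 < s := by
    refine lt_of_pow_lt_pow_left₀ 2 hs0 ?_
    nlinarith [mul_pos (sub_pos.2 hγ) (show 0 < γ + 1 by linarith)]
  subst hβ
  refine ⟨by linarith, by linarith, ?_⟩
  linear_combination hsq / 4

theorem sq_add_self_strictMonoOn : StrictMonoOn (fun c : ℝ => c ^ 2 + c) (Set.Ici 0) := by
  intro x hx y hy hxy
  rw [Set.mem_Ici] at hx hy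
  change x ^ 2 + x < y ^ 2 + y
  nlinarith

/-- For fixed `γ`, `hfun` is minimal in `β` on the curve where its first partial derivative
vanishes. -/
theorem hfun_le_of_curve {α q γ β₀ β : ℝ} (hγ : 0 < γ)
    (hβ₀ : 0 < β₀) (h₀ : β₀ + γ < α) (hcurve : (α - β₀) ^ 2 + (α - β₀) = α * (γ + 1))
    (hβ : 0 < β) (h : β + γ < α) : hfun α q β₀ γ ≤ hfun α q β γ := by
  refine isMinOn_Ioo_of_hasDerivAt (f := fun b => hfun α q b γ)
    (f' := fun b => hfunPartialBeta α b γ) (a := 0) (b := α - γ) (c := β₀)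
    ⟨hβ₀, by linarith⟩ (fun x hx => hasDerivAt_hfun_left hx.1 hγ (by linarith [hx.2]))
    (fun x hx => ?_) (fun x hx => ?_) (show β ∈ Set.Ioo 0 (α - γ) from ⟨hβ, by linarith⟩)
  · have hlt : (α - β₀) ^ 2 + (α - β₀) < (α - x) ^ 2 + (α - x) :=
      sq_add_self_strictMonoOn (Set.mem_Ici.2 (by linarith)) (Set.mem_Ici.2 (by linarith [hx.2]))
        (by linarith [hx.2])
    refine (sign_eq_neg_one_iff.1 ?_).le
    rw [sign_hfunPartialBeta hx.1 hγ (by linarith [hx.2]), sign_neg (by linarith)]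
  · have hlt : (α - x) ^ 2 + (α - x) < (α - β₀) ^ 2 + (α - β₀) :=
      sq_add_self_strictMonoOn (Set.mem_Ici.2 (by linarith [hx.2])) (Set.mem_Ici.2 (by linarith))
        (by linarith [hx.1])
    refine (sign_eq_one_iff.1 ?_).le
    rw [sign_hfunPartialBeta (hβ₀.trans hx.1) hγ (by linarith [hx.2]), sign_pos (by linarith)]

/-- Along the curve where the first partial derivative vanishes, `hfun` is minimal where
`γ = gamma1 α q`. -/
theorem hfun_curve_le {α q β₁ β γ : ℝ} (hα : 0 < α) (hq0 : 0 < q) (hq1 : q < 1)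
    (hβ₁ : 0 < β₁) (h₁ : β₁ + gamma1 α q < α)
    (hcurve₁ : (α - β₁) ^ 2 + (α - β₁) = α * (gamma1 α q + 1))
    (hβ : 0 < β) (hγ : 0 < γ) (h : β + γ < α)
    (hcurve : (α - β) ^ 2 + (α - β) = α * (γ + 1)) :
    hfun α q β₁ (gamma1 α q) ≤ hfun α q β γ := by
  have hγ₁ := gamma1_pos hα hq0
  obtain ⟨-, hm, hmcurve⟩ := smaller_root_spec hα le_rfl hα rfl
  set m := ((2 * α + 1) - Real.sqrt ((2 * α + 1) ^ 2 - 4 * (α ^ 2 - α * 0))) / 2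
  set g : ℝ → ℝ := fun c => (c ^ 2 + c) / α - 1 with hg
  have hgα (c : ℝ) : c ^ 2 + c = α * (g c + 1) := by simp only [hg]; field_simp; ring
  have hg_lt {c d : ℝ} (hc : 0 ≤ c) (hcd : c < d) : g c < g d := by
    have h2 := sq_add_self_strictMonoOn (Set.mem_Ici.2 hc) (Set.mem_Ici.2 (hc.trans hcd.le)) hcd
    simp only [hg]
    gcongr
  have hg_eq {c d : ℝ} (hd : c ^ 2 + c = α * (d + 1)) : g c = d := by
    simp only [hg, hd]; field_simp; ring
  have hg₁ : g (α - β₁) = gamma1 α q := hg_eq hcurve₁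
  have hgγ : g (α - β) = γ := hg_eq hcurve
  have hgm : g (α - m) = 0 := hg_eq hmcurve
  have hgpos {c : ℝ} (hc : α - m < c) : 0 < g c := hgm ▸ hg_lt (by linarith) hc
  have hgsum {c : ℝ} (hc0 : 0 < c) (hc : c < α) : α - c + g c < α := by
    have : α * (g c - c) < 0 := by
      nlinarith [hgα c, mul_pos (sub_pos.2 hc) (by linarith : 0 < c + 1)]
    nlinarith
  have hlow {b : ℝ} (hb : b < α) (hb0 : 0 < g (α - b)) : α - m < α - b := by
    by_contra! hle
    rcases hle.eq_or_lt with heq | hlt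
    · rw [heq, hgm] at hb0; exact hb0.false
    · linarith [hg_lt (by linarith) hlt]
  have key := isMinOn_Ioo_of_hasDerivAt (f := fun c => hfun α q (α - c) (g c))
    (f' := fun c => hfunPartialGamma α q (α - c) (g c) * ((2 * c + 1) / α))
    (a := α - m) (b := α) (c := α - β₁)
    ⟨hlow (by linarith) (hg₁ ▸ hγ₁), by linarith⟩ (fun c hc => ?_) (fun c hc => ?_) (fun c hc => ?_)
    (show α - β ∈ Set.Ioo (α - m) α from ⟨hlow (by linarith) (hgγ ▸ hγ), by linarith⟩)
  · simpa [hg₁, hgγ] using key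
  · have hgd : HasDerivAt g ((2 * c + 1) / α) c := by
      simpa [hg] using (((hasDerivAt_pow 2 c).add (hasDerivAt_id c)).div_const α).sub_const 1
    have hc0 : 0 < α - c := by linarith [hc.2]
    have hsum := hgsum (by linarith [hc.1] : 0 < c) hc.2
    have hz : hfunPartialBeta α (α - c) (g c) = 0 :=
      (hfunPartialBeta_eq_zero_iff hc0 (hgpos hc.1) hsum).2 (by simpa using hgα c)
    have := hasDerivAt_hfun_comp (q := q) ((hasDerivAt_id c).const_sub α) hgd hc0 (hgpos hc.1) hsum
    simpa [hz] using this
  · have hc0 : 0 < c := by linarith [hc.1]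
    have hcα : c < α := by linarith [hc.2]
    refine mul_nonpos_of_nonpos_of_nonneg (sign_eq_neg_one_iff.1 ?_).le (by positivity)
    rw [sign_hfunPartialGamma hq0 hq1 (hgpos hc.1) (hgsum hc0 hcα)
      (by simpa using hgα c), sign_sub_gamma1 hα hq0 (hgpos hc.1), ← hg₁]
    exact sign_neg (sub_neg.2 (hg_lt hc0.le hc.2))
  · have hc0 : 0 < c := by linarith [hc.1]
    have hcm : α - m < c := (hlow (by linarith) (hg₁ ▸ hγ₁)).trans hc.1
    refine mul_nonneg (sign_eq_one_iff.1 ?_).le (by positivity)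
    rw [sign_hfunPartialGamma hq0 hq1 (hgpos hcm) (hgsum hc0 hc.2)
      (by simpa using hgα c), sign_sub_gamma1 hα hq0 (hgpos hcm), ← hg₁]
    exact sign_pos (sub_pos.2 (hg_lt (by linarith) hc.1))

/-- `(β1, γ1)` lies in the open region `{0 < β, 0 < γ, β + γ < α}`, it is the unique point of
this region where both partial derivatives of `h` vanish, and `h` attains its global minimum
over the region there. -/
theorem hfun_isMinOn_unique_critical_point
    (α q : ℝ) (hα : 0 < α) (hq : q ∈ Set.Ioo (0 : ℝ) 1) :
    (0 < beta1 α q ∧ 0 < gamma1 α q ∧ beta1 α q + gamma1 α q < α) ∧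
    HasDerivAt (fun b => hfun α q b (gamma1 α q)) 0 (beta1 α q) ∧
    HasDerivAt (fun g => hfun α q (beta1 α q) g) 0 (gamma1 α q) ∧
    (∀ β γ : ℝ, 0 < β → 0 < γ → β + γ < α →
      HasDerivAt (fun b => hfun α q b γ) 0 β →
      HasDerivAt (fun g => hfun α q β g) 0 γ →
      β = beta1 α q ∧ γ = gamma1 α q) ∧
    (∀ β γ : ℝ, 0 < β → 0 < γ → β + γ < α →
      hfun α q (beta1 α q) (gamma1 α q) ≤ hfun α q β γ) := by
  obtain ⟨hq0, hq1⟩ := hq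
  have hγ₁ := gamma1_pos hα hq0
  obtain ⟨hβ₁, h₁, hcurve₁⟩ :=
    smaller_root_spec (β := beta1 α q) hα hγ₁.le (gamma1_lt hα hq0 hq1) rfl
  have hzβ := (hfunPartialBeta_eq_zero_iff hβ₁ hγ₁ h₁).2 hcurve₁
  have hzγ := (hfunPartialGamma_eq_zero_iff hq0 hq1 hγ₁ h₁ hcurve₁).2 (gamma1_sq hα hq0)
  refine ⟨⟨hβ₁, hγ₁, h₁⟩, hzβ ▸ hasDerivAt_hfun_left hβ₁ hγ₁ h₁,
    hzγ ▸ hasDerivAt_hfun_right hβ₁ hγ₁ h₁, ?_, ?_⟩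
  · intro β γ hβ hγ h hdβ hdγ
    have hcurve := (hfunPartialBeta_eq_zero_iff hβ hγ h).1
      ((hasDerivAt_hfun_left hβ hγ h).unique hdβ)
    have hγeq := (hfunPartialGamma_eq_zero_iff hq0 hq1 hγ h hcurve).1
      ((hasDerivAt_hfun_right hβ hγ h).unique hdγ)
    have hs := sign_sub_gamma1 hα hq0 hγ
    rw [sub_eq_zero.2 hγeq, sign_zero, eq_comm, sign_eq_zero_iff, sub_eq_zero] at hs
    subst hs
    have := sq_add_self_strictMonoOn.injOn (Set.mem_Ici.2 (by linarith : 0 ≤ α - β))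
      (Set.mem_Ici.2 (by linarith : 0 ≤ α - beta1 α q)) (hcurve.trans hcurve₁.symm)
    exact ⟨by linarith, rfl⟩
  · intro β γ hβ hγ h
    obtain ⟨hβ₀, h₀, hcurve₀⟩ := smaller_root_spec hα hγ.le (by linarith) rfl
    exact (hfun_curve_le hα hq0 hq1 hβ₁ h₁ hcurve₁ hβ₀ hγ h₀ hcurve₀).trans
      (hfun_le_of_curve hγ hβ₀ h₀ hcurve₀ hβ h)

end
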